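/- For a connected multigraph G, the determinant of the reduced weighted Laplacian-type matrix M_G (obtained from the block matrix [[A, E],[-E^T, 0]] by deleting the row and column of one vertex, where A is the diagonal matrix of edge variables α_e and E the signed incidence matrix) equals the Kirchhoff graph polynomial Ψ_G = Σ_{T spanning tree} Π_{e ∉ T} α_e. -/

import Mathlib

/-- A finite multigraph with oriented edges: each edge has a source and a target vertex.
Self-loops (src = tgt) and parallel edges are allowed. -/
structure Multigraph (E V : Type*) where
  src : E → V
  tgt : E → V

namespace Multigraph

variable {E V : Type*}

/-- Two vertices are adjacent via an edge of the subset `F`. -/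
def Adj (G : Multigraph E V) (F : Finset E) (a b : V) : Prop :=
  ∃ e ∈ F, (G.src e = a ∧ G.tgt e = b) ∨ (G.src e = b ∧ G.tgt e = a)

/-- Reachability (connectivity) using only edges in `F`. -/
def Reach (G : Multigraph E V) (F : Finset E) : V → V → Prop :=
  Relation.ReflTransGen (G.Adj F)

/-- `T` is (the edge set of) a spanning tree of `G`: it connects all vertices and has
`|V| - 1` edges. -/
def IsSpanningTree (G : Multigraph E V) [Fintype V] (T : Finset E) : Prop :=
  (∀ v w : V, G.Reach T v w) ∧ T.card + 1 = Fintype.card V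

/-- `G` is connected. -/
def Connected (G : Multigraph E V) [Fintype E] [Fintype V] : Prop :=
  ∀ v w : V, G.Reach Finset.univ v w

/-- The signed incidence matrix entry of edge `e` at vertex `v`:
`+1` if `e` begins at `v`, `-1` if `e` ends at `v`, `0` otherwise (in particular `0`
for self-loops). -/
def inc (G : Multigraph E V) (R : Type*) [Ring R] [DecidableEq V] (e : E) (v : V) : R :=
  (if G.src e = v then 1 else 0) - (if G.tgt e = v then 1 else 0)

open Classical in
/-- The Kirchhoff (graph) polynomial `Ψ_G = Σ_T Π_{e ∉ T} α_e`, sum over spanning trees. -/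
noncomputable def kirchhoff (G : Multigraph E V) [Fintype E] [DecidableEq E] [Fintype V] :
    MvPolynomial E ℚ :=
  ∑ T : Finset E, if G.IsSpanningTree T then ∏ e ∈ Tᶜ, MvPolynomial.X e else 0

/-- `F` is a spanning forest of `G` whose trees realize the partition `parts` of a subset of
the vertices: it has `|V| - |parts|` edges (forcing acyclicity), vertices in the same part
are connected, vertices in different parts are disconnected, and every vertex lies in the
tree of some part. -/
def IsSpanningForest (G : Multigraph E V) [Fintype V] (parts : Finset (Finset V))
    (F : Finset E) : Prop :=
  F.card + parts.card = Fintype.card V ∧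
  (∀ p ∈ parts, ∀ v ∈ p, ∀ w ∈ p, G.Reach F v w) ∧
  (∀ p ∈ parts, ∀ q ∈ parts, p ≠ q → ∀ v ∈ p, ∀ w ∈ q, ¬ G.Reach F v w) ∧
  (∀ v : V, ∃ p ∈ parts, ∃ w ∈ p, G.Reach F v w)

open Classical in
/-- The spanning forest polynomial `Φ^P_G = Σ_F Π_{e ∉ F} α_e`. -/
noncomputable def forestPoly (G : Multigraph E V) [Fintype E] [DecidableEq E] [Fintype V]
    (parts : Finset (Finset V)) : MvPolynomial E ℚ :=
  ∑ F : Finset E, if G.IsSpanningForest parts F then ∏ e ∈ Fᶜ, MvPolynomial.X e else 0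

end Multigraph

/-- `parts` is a set partition (of the union of its parts): parts are nonempty and
pairwise disjoint. -/
def IsSetPartition {V : Type*} (parts : Finset (Finset V)) : Prop :=
  ∅ ∉ parts ∧ ∀ p ∈ parts, ∀ q ∈ parts, p ≠ q → Disjoint p q

/-- `parts` is a set partition of the finite vertex set `W`. -/
def IsPartitionOf {V : Type*} (W : Finset V) (parts : Finset (Finset V)) : Prop :=
  IsSetPartition parts ∧ (∀ p ∈ parts, p ⊆ W) ∧ ∀ v ∈ W, ∃ p ∈ parts, v ∈ p

namespace Multigraph

/-- The reduced matrix `M_G`: the block matrix `[[A, 𝓔],[-𝓔ᵀ, 0]]` with the row and column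
corresponding to the chosen vertex `v0` deleted, where `A` is the diagonal matrix of the
edge variables and `𝓔` the signed incidence matrix. -/
noncomputable def MG {E V : Type*} (G : Multigraph E V) [DecidableEq E] [DecidableEq V]
    (v0 : V) :
    Matrix (E ⊕ {v : V // v ≠ v0}) (E ⊕ {v : V // v ≠ v0}) (MvPolynomial E ℚ) :=
  Matrix.fromBlocks (Matrix.diagonal fun e => MvPolynomial.X e)
    (Matrix.of fun e (v : {v : V // v ≠ v0}) => G.inc (MvPolynomial E ℚ) e ↑v)
    (Matrix.of fun (v : {v : V // v ≠ v0}) e => -G.inc (MvPolynomial E ℚ) e ↑v)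
    0

end Multigraph

namespace Matrix

variable {E W R : Type*} [DecidableEq E] [CommRing R]

/-- The matrix obtained from `[[diag x, B], [-Bᵀ, 0]]` by keeping, in each upper row `e`, only
the entries of `B` if `e ∈ T`, and only the diagonal entry, replaced by `1`, if `e ∉ T`. -/
def selectRows (B : Matrix E W R) (T : Finset E) : Matrix (E ⊕ W) (E ⊕ W) R :=
  fromBlocks (diagonal fun e => if e ∈ T then 0 else 1)
    (of fun e w => if e ∈ T then B e w else 0) (-Bᵀ) 0

variable [Fintype E] [Fintype W] [DecidableEq W]

theorem det_fromBlocks_diagonal_eq_sum_selectRows (x : E → R) (B : Matrix E W R) :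
    (fromBlocks (diagonal x) B (-Bᵀ) 0).det =
      ∑ T : Finset E, (∏ e ∈ Tᶜ, x e) * (B.selectRows T).det := by
  let M (m : E → E ⊕ W → R) : Matrix (E ⊕ W) (E ⊕ W) R :=
    of (Sum.elim m fun w => Sum.elim (fun e => -B e w) 0)
  have hM (m : E → E ⊕ W → R) (e : E) (a : E ⊕ W → R) :
      M (Function.update m e a) = (M m).updateRow (Sum.inl e) a :=
    (Sum.update_elim_inl ..).symm
  let f : MultilinearMap R (fun _ : E => E ⊕ W → R) R :=
    MultilinearMap.mk' (fun m => (M m).det)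
      (fun m e a b => by simp only [hM, det_updateRow_add])
      (fun m e c a => by simp only [hM, det_updateRow_smul, smul_eq_mul])
  let p : E → E ⊕ W → R := fun e => Sum.elim 0 (B e)
  let q : E → E ⊕ W → R := fun e => Pi.single (Sum.inl e) 1
  have h : (fromBlocks (diagonal x) B (-Bᵀ) 0).det = f (p + fun e => x e • q e) := by
    change _ = det _
    congr 1
    ext (e | w) (e' | w') <;> simp [M, p, q, diagonal_apply, Pi.single_apply, eq_comm]
  rw [h, f.map_add_univ]
  refine Finset.sum_congr rfl fun T _ => ?_
  have hT : T.piecewise p (fun e => x e • q e) =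
      Tᶜ.piecewise (fun e => x e • T.piecewise p q e) (T.piecewise p q) := by
    ext e : 1
    by_cases he : e ∈ T <;> simp [he]
  rw [hT, f.map_piecewise_smul, smul_eq_mul]
  congr 1
  change det _ = det _
  congr 1
  ext (e | w) (e' | w')
  · by_cases he : e ∈ T <;>
      simp [M, selectRows, p, q, diagonal_apply, Pi.single_apply, he, eq_comm]
  · by_cases he : e ∈ T <;> simp [M, selectRows, p, q, he]
  · simp [M, selectRows]
  · simp [M, selectRows]

theorem det_selectRows_eq_zero_of_mulVec [IsDomain R] {B : Matrix E W R} {T : Finset E}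
    {y : W → R} (hy : y ≠ 0) (h : ∀ e ∈ T, (B *ᵥ y) e = 0) : (B.selectRows T).det = 0 := by
  rw [← exists_mulVec_eq_zero_iff]
  refine ⟨Sum.elim 0 y, fun h0 => hy (funext fun w => congrFun h0 (Sum.inr w)), ?_⟩
  rw [selectRows, fromBlocks_mulVec]
  ext (e | w)
  · by_cases he : e ∈ T
    · simpa [mulVec, dotProduct, he] using h e he
    · simp [mulVec, dotProduct, he]
  · simp

theorem det_selectRows_eq_zero_of_card_ne [IsDomain R] (B : Matrix E W R) {T : Finset E}
    (hT : T.card ≠ Fintype.card W) : (B.selectRows T).det = 0 := by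
  let C : Matrix T W R := B.submatrix (↑) id
  rcases lt_or_gt_of_ne hT with hlt | hgt
  · have hC : ¬ Function.Injective C.mulVecLin := fun hinj => by
      simpa using hlt.trans_le (card_le_of_injective R _ hinj)
    rw [injective_iff_map_eq_zero] at hC
    push Not at hC
    obtain ⟨y, hy, hy0⟩ := hC
    exact det_selectRows_eq_zero_of_mulVec hy0 fun e he => congrFun hy ⟨e, he⟩
  · have hC : ¬ Function.Injective C.vecMulLinear := fun hinj => by
      have := card_le_of_injective R _ hinj
      rw [Fintype.card_coe] at this
      omega
    rw [injective_iff_map_eq_zero] at hC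
    push Not at hC
    obtain ⟨x, hx, hx0⟩ := hC
    rw [← exists_mulVec_eq_zero_iff]
    let z : E → R := fun e => if he : e ∈ T then x ⟨e, he⟩ else 0
    refine ⟨Sum.elim z 0, fun h0 => hx0 (funext fun e => ?_), ?_⟩
    · simpa [z] using congrFun h0 (Sum.inl e.1)
    rw [selectRows, fromBlocks_mulVec]
    ext (e | w)
    · by_cases he : e ∈ T <;> simp [mulVec_diagonal, he, z]
    · have hw : ∑ e : T, x e * B e w = 0 := congrFun hx w
      have : ∑ e, B e w * z e = 0 := by
        rw [← hw, ← Finset.sum_subset (Finset.subset_univ T), ← Finset.sum_coe_sort T]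
        · exact Finset.sum_congr rfl fun e _ => by simp [z, mul_comm]
        · intro e _ he
          simp [z, he]
      simpa [mulVec, dotProduct] using this

theorem det_selectRows_of_isUnit (B : Matrix E W R) {T : Finset E} (σ : W ≃ T)
    (h : IsUnit (B.submatrix (fun w => (σ w : E)) id)) :
    (B.selectRows T).det = (B.submatrix (fun w => (σ w : E)) id).det ^ 2 := by
  set C := B.submatrix (fun w => (σ w : E)) id with hC
  have hdet : IsUnit C.det := (isUnit_iff_isUnit_det C).1 h
  let X : Matrix W E R :=
    of fun w e => if he : e ∈ T then C⁻¹ w (σ.symm ⟨e, he⟩) else 0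
  let B' : Matrix E W R := of fun e w => if e ∈ T then B e w else 0
  have hX : diagonal (fun e => if e ∈ T then 0 else 1) + B' * X = 1 := by
    ext e e'
    by_cases he : e ∈ T
    · by_cases he' : e' ∈ T
      · have := congrFun (congrFun (mul_nonsing_inv C hdet) (σ.symm ⟨e, he⟩)) (σ.symm ⟨e', he'⟩)
        simpa [mul_apply, hC, X, B', he, he', one_apply, diagonal_apply] using this
      · have hne : e ≠ e' := fun h => he' (h ▸ he)
        simp [mul_apply, X, he', hne]
    · simp [mul_apply, B', he, one_apply, diagonal_apply]
  have hmul : B.selectRows T * fromBlocks 1 0 X 1 = fromBlocks 1 B' (-Bᵀ) 0 := by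
    rw [selectRows, fromBlocks_multiply]
    simp only [Matrix.mul_one, Matrix.mul_zero, Matrix.zero_mul, zero_add, add_zero]
    congr 1
  have hBB : Bᵀ * B' = Cᵀ * C := by
    ext w w'
    simp only [mul_apply, transpose_apply, hC, submatrix_apply, id, B', of_apply]
    rw [σ.sum_comp fun e : T => B e w * B e w',
      Finset.sum_coe_sort T fun e => B e w * B e w']
    simp [Finset.sum_ite_mem]
  have := congrArg det hmul
  rw [det_mul, det_fromBlocks_zero₁₂, det_one, det_one, mul_one, mul_one,
    det_fromBlocks_one₁₁, Matrix.neg_mul, sub_neg_eq_add, zero_add, hBB, det_mul,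
    det_transpose] at this
  rw [this, sq]

omit [Fintype E] [Fintype W] [DecidableEq W] in
theorem map_selectRows {S : Type*} [CommRing S] (f : R →+* S) (B : Matrix E W R)
    (T : Finset E) : (B.selectRows T).map f = (B.map f).selectRows T := by
  ext (e | w) (e' | w')
  · simp [selectRows, diagonal_apply, apply_ite f]
  · simp [selectRows, apply_ite f]
  · simp [selectRows]
  · simp [selectRows]

end Matrix

namespace Multigraph

variable {E V : Type*} [DecidableEq V] (G : Multigraph E V) (v0 : V)

/-- The integral signed incidence matrix without the column of the vertex `v0`. -/
def reducedInc : Matrix E {v : V // v ≠ v0} ℤ :=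
  Matrix.of fun e v => G.inc ℤ e v

omit [DecidableEq V] in
theorem Reach.symm {G : Multigraph E V} {F : Finset E} {a b : V} (h : G.Reach F a b) :
    G.Reach F b a := by
  refine Relation.ReflTransGen.mono ?_ _ _ h.swap
  rintro a b ⟨e, he, h⟩
  exact ⟨e, he, h.symm⟩

variable [Fintype V]

theorem exists_mulVec_reducedInc_eq_zero {T : Finset E} {v : V} (hv : ¬ G.Reach T v0 v) :
    ∃ y ≠ 0, ∀ e ∈ T, (G.reducedInc v0).mulVec y e = 0 := by
  classical
  let c : V → ℤ := fun w => if G.Reach T v0 w then 0 else 1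
  have hv0 : c v0 = 0 := if_pos Relation.ReflTransGen.refl
  refine ⟨fun w => c w, fun h => ?_, fun e he => ?_⟩
  · have hne : v ≠ v0 := fun h => hv (h ▸ Relation.ReflTransGen.refl)
    simpa [c, hv] using congrFun h ⟨v, hne⟩
  · have hsum : (G.reducedInc v0).mulVec (fun w => c w) e = ∑ w, G.inc ℤ e w * c w := by
      rw [← Fintype.sum_subtype_add_sum_subtype (· ≠ v0)]
      have : ∑ w : {w // ¬ w ≠ v0}, G.inc ℤ e w * c w = 0 :=
        Finset.sum_eq_zero fun w _ => by rw [not_not.1 w.2, hv0, mul_zero]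
      rw [this, add_zero]
      rfl
    have hst : G.Reach T v0 (G.src e) ↔ G.Reach T v0 (G.tgt e) :=
      ⟨fun h => h.tail ⟨e, he, Or.inl ⟨rfl, rfl⟩⟩, fun h => h.tail ⟨e, he, Or.inr ⟨rfl, rfl⟩⟩⟩
    rw [hsum]
    simp only [inc, sub_mul, ite_mul, one_mul, zero_mul, Finset.sum_sub_distrib,
      Finset.sum_ite_eq, Finset.mem_univ, if_true, c, hst, sub_self]

omit [Fintype V] in
theorem exists_vecMul_reducedInc {T : Finset E} {v : V} (hv : G.Reach T v0 v) :
    ∃ x : T → ℤ, Matrix.vecMul x ((G.reducedInc v0).submatrix (fun e : T => (e : E)) id) =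
      fun w : {w : V // w ≠ v0} => if (w : V) = v then (1 : ℤ) else 0 := by
  classical
  induction hv with
  | refl => exact ⟨0, by ext w; simp [w.2]⟩
  | @tail b c _ hbc ih =>
    obtain ⟨x, hx⟩ := ih
    obtain ⟨e, he, h⟩ := hbc
    have key (ε : ℤ) : Matrix.vecMul (x + Pi.single (⟨e, he⟩ : T) ε)
        ((G.reducedInc v0).submatrix (fun e : T => (e : E)) id) =
          fun w : {w : V // w ≠ v0} => (if (w : V) = b then 1 else 0) + ε * G.inc ℤ e w := by
      rw [Matrix.add_vecMul, hx]
      ext w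
      simp [reducedInc]
    rcases h with ⟨hs, ht⟩ | ⟨hs, ht⟩
    · refine ⟨_, (key (-1)).trans (funext fun w => ?_)⟩
      simp [inc, hs, ht, eq_comm]
    · refine ⟨_, (key 1).trans (funext fun w => ?_)⟩
      simp [inc, hs, ht, eq_comm]

variable [DecidableEq E] [Fintype E]

open Classical in
theorem det_selectRows_reducedInc (T : Finset E) :
    ((G.reducedInc v0).selectRows T).det = if G.IsSpanningTree T then 1 else 0 := by
  have hcard : Fintype.card {v : V // v ≠ v0} + 1 = Fintype.card V := by
    have := Fintype.card_pos_iff.2 ⟨v0⟩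
    simp only [ne_eq, Fintype.card_subtype_compl, Fintype.card_unique]
    omega
  by_cases hreach : ∀ v, G.Reach T v0 v
  swap
  · push Not at hreach
    obtain ⟨v, hv⟩ := hreach
    obtain ⟨y, hy, h⟩ := G.exists_mulVec_reducedInc_eq_zero v0 hv
    rw [if_neg fun hT => hv (hT.1 v0 v), Matrix.det_selectRows_eq_zero_of_mulVec hy h]
  by_cases hT : T.card = Fintype.card {v : V // v ≠ v0}
  swap
  · rw [if_neg fun h => hT (by have := h.2; omega), Matrix.det_selectRows_eq_zero_of_card_ne _ hT]
  rw [if_pos ⟨fun v w => (hreach v).symm.trans (hreach w), by omega⟩]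
  let σ : {v : V // v ≠ v0} ≃ T := Fintype.equivOfCardEq (by rw [Fintype.card_coe, hT])
  have hunit : IsUnit ((G.reducedInc v0).submatrix (fun w => (σ w : E)) id) := by
    choose x hx using fun v => G.exists_vecMul_reducedInc v0 (hreach v)
    rw [isUnit_iff_exists_inv']
    refine ⟨Matrix.of fun v w => x v (σ w), ?_⟩
    ext v w
    have := congrFun (hx v) w
    simp only [Matrix.vecMul, dotProduct] at this
    rw [← σ.sum_comp] at this
    simpa [Matrix.mul_apply, Matrix.one_apply, Subtype.ext_iff, eq_comm] using this
  rw [Matrix.det_selectRows_of_isUnit _ σ hunit]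
  exact Int.isUnit_sq ((Matrix.isUnit_iff_isUnit_det _).1 hunit)

end Multigraph

/-- For a connected multigraph `G`, the determinant of the reduced matrix
`M_G` equals the Kirchhoff graph polynomial `Ψ_G = Σ_{T spanning tree} Π_{e ∉ T} α_e`. -/
theorem det_MG_eq_kirchhoff {E V : Type*} [Fintype E] [DecidableEq E] [Fintype V]
    [DecidableEq V] (G : Multigraph E V) (hconn : G.Connected) (v0 : V) :
    (G.MG v0).det = G.kirchhoff := by
  have hMG : G.MG v0 = Matrix.fromBlocks (Matrix.diagonal MvPolynomial.X)
      ((G.reducedInc v0).map (Int.castRingHom (MvPolynomial E ℚ)))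
      (-((G.reducedInc v0).map (Int.castRingHom (MvPolynomial E ℚ))).transpose) 0 := by
    ext1 (e | w) (e' | w')
    · rfl
    · simp [Multigraph.MG, Multigraph.reducedInc, Multigraph.inc]
    · simp [Multigraph.MG, Multigraph.reducedInc, Multigraph.inc]
    · rfl
  rw [hMG, Matrix.det_fromBlocks_diagonal_eq_sum_selectRows, Multigraph.kirchhoff]
  refine Finset.sum_congr rfl fun T _ => ?_
  rw [← Matrix.map_selectRows, ← RingHom.mapMatrix_apply, ← RingHom.map_det,
    G.det_selectRows_reducedInc v0 T]
  split_ifs <;> simp
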